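/- Let T be a finite set of terminals carrying a real power value p : T → ℝ, partitioned into bus terminals T_B and non-bus terminals T_C. Suppose the bus terminals are partitioned into finitely many buses, and for each bus the sum of p over its terminals is zero (Kirchhoff's current law). Suppose further that the connection set L is a perfect matching that pairs every bus terminal with exactly one non-bus terminal and vice versa, and for every connected pair (i, j) ∈ L we have p_i + p_j = 0. Then the total net power injected by all non-bus components is zero: Σ_{i ∈ T_C} p_i = 0. -/

import Mathlib

/-- In the component-oriented network model: terminals `T` carry real powers `p`,
and are partitioned into bus terminals `TB` and non-bus terminals `TC`.  The bus
terminals are partitioned into buses (indexed by `ι`, via the assignment `bus`),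
and each bus satisfies Kirchhoff's current law (its terminal powers sum to zero).
The connections form a perfect matching `e` pairing every bus terminal with exactly
one non-bus terminal and vice versa, with `p i + p (e i) = 0` across each connection.
Then the total net power injected by all non-bus components is zero. -/
theorem total_nonbus_power_zero
    {T : Type*} [Fintype T] [DecidableEq T] {ι : Type*} [Fintype ι] [DecidableEq ι]
    (p : T → ℝ) (TB TC : Finset T)
    (hdisj : Disjoint TB TC) (hcover : TB ∪ TC = Finset.univ)
    (bus : T → ι)
    (hKCL : ∀ k : ι, ∑ i ∈ TB.filter (fun i => bus i = k), p i = 0)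
    (e : ↥TB ≃ ↥TC)
    (hmatch : ∀ i : ↥TB, p (i : T) + p ((e i : T)) = 0) :
    ∑ i ∈ TC, p i = 0 := by
  have hbus : ∑ i ∈ TB, p i = 0 := by
    rw [← Finset.sum_fiberwise TB bus p]
    exact Finset.sum_eq_zero fun k _ => hKCL k
  calc ∑ i ∈ TC, p i = ∑ j : ↥TC, p j := (Finset.sum_coe_sort TC p).symm
    _ = ∑ i : ↥TB, p (e i) := (Equiv.sum_comp e fun j : ↥TC => p j).symm
    _ = ∑ i : ↥TB, -p i :=
      Finset.sum_congr rfl fun i _ => eq_neg_of_add_eq_zero_right (hmatch i)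
    _ = 0 := by rw [Finset.sum_neg_distrib, Finset.sum_coe_sort TB p, hbus, neg_zero]
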